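/- Let d ∈ ℕ, d ≥ 1, and let β ∈ ℝ with β > −d − 1. Then there exists a finite constant C = C(β,d) > 0 such that for all k, l ∈ ℤ^d with k ≠ l, ∫_{k+[0,1]^d} ∫_{l+[0,1]^d} ‖x − y‖^β dx dy ≤ C · ( max_{1≤j≤d} |k_j − l_j| )^β, where ‖·‖ is the Euclidean norm on ℝ^d. -/

import Mathlib

open MeasureTheory
open scoped ENNReal

/-- The closed axis-parallel box with opposite corners `a` and `b`. -/
def euclideanBox {d : ℕ} (a b : Fin d → ℝ) : Set (EuclideanSpace ℝ (Fin d)) :=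
  {x | ∀ j, x j ∈ Set.Icc (a j) (b j)}

lemma euclideanBox_eq_preimage {d : ℕ} (a b : Fin d → ℝ) :
    euclideanBox a b = WithLp.ofLp ⁻¹' Set.Icc a b := by
  ext x
  simp [euclideanBox, Pi.le_def, forall_and]

lemma measurableSet_euclideanBox {d : ℕ} (a b : Fin d → ℝ) :
    MeasurableSet (euclideanBox a b) := by
  rw [euclideanBox_eq_preimage]
  exact (PiLp.volume_preserving_ofLp (Fin d)).measurable measurableSet_Icc

lemma volume_euclideanBox {d : ℕ} (a b : Fin d → ℝ) :
    volume (euclideanBox a b) = ∏ j, ENNReal.ofReal (b j - a j) := by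
  rw [euclideanBox_eq_preimage, (PiLp.volume_preserving_ofLp (Fin d)).measure_preimage
    measurableSet_Icc.nullMeasurableSet, Real.volume_Icc_pi]

lemma volume_euclideanBox_add_one {d : ℕ} (a : Fin d → ℝ) :
    volume (euclideanBox a (fun j => a j + 1)) = 1 := by
  simp [volume_euclideanBox]

lemma EuclideanSpace.norm_le_mul_of_abs_apply_le {d : ℕ} {v : EuclideanSpace ℝ (Fin d)} {r : ℝ}
    (hv : ∀ j, |v j| ≤ r) : ‖v‖ ≤ d * r := by
  calc ‖v‖ = ‖∑ j, EuclideanSpace.single j (v j)‖ := by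
        congr 1
        ext i
        simp [Finset.sum_apply]
    _ ≤ ∑ j, ‖EuclideanSpace.single j (v j)‖ := norm_sum_le _ _
    _ ≤ ∑ _j : Fin d, r := Finset.sum_le_sum fun j _ => by simpa using hv j
    _ = d * r := by simp

lemma lintegral_ball_norm_rpow_lt_top {d : ℕ} (hd : 1 ≤ d) {γ : ℝ} (hγ : -(d : ℝ) < γ) (r : ℝ) :
    ∫⁻ w in Metric.ball (0 : EuclideanSpace ℝ (Fin d)) r, ENNReal.ofReal (‖w‖ ^ γ) < ∞ := by
  have h : IntegrableOn (fun w : EuclideanSpace ℝ (Fin d) => ‖w‖ ^ γ) (Metric.ball 0 r) := by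
    refine integrableOn_ball_of_norm_le_rpow (C := 1) (α := -γ) (by simpa using hd)
      (by simpa using by linarith) (ae_of_all _ fun w => ?_)
      (measurable_norm.pow_const γ).aestronglyMeasurable
    simp [abs_of_nonneg (Real.rpow_nonneg (norm_nonneg w) γ)]
  exact h.lintegral_lt_top

/-- Fubini, after the substitution `w = x - y`. -/
lemma setLIntegral_setLIntegral_sub {E : Type*} [AddCommGroup E] [MeasurableSpace E]
    [MeasurableAdd₂ E] [MeasurableNeg E] {μ : Measure E} [SFinite μ] [μ.IsAddLeftInvariant]
    [μ.IsNegInvariant] {K L : Set E} (hL : MeasurableSet L)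
    {f : E → ℝ≥0∞} (hf : Measurable f) :
    ∫⁻ x in K, ∫⁻ y in L, f (x - y) ∂μ ∂μ = ∫⁻ w, f w * μ (K ∩ {x | x - w ∈ L}) ∂μ := by
  have hsub : Measurable fun p : E × E => p.1 - p.2 := by
    simp only [sub_eq_add_neg]
    fun_prop
  have hS (w : E) : MeasurableSet {x | x - w ∈ L} := hsub.comp measurable_prodMk_right hL
  calc ∫⁻ x in K, ∫⁻ y in L, f (x - y) ∂μ ∂μ
      = ∫⁻ x in K, ∫⁻ w, L.indicator 1 (x - w) * f w ∂μ ∂μ := by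
        refine lintegral_congr fun x => ?_
        rw [← lintegral_indicator hL,
          ← lintegral_sub_left_eq_self (fun w => L.indicator 1 (x - w) * f w) x]
        refine lintegral_congr fun y => ?_
        by_cases hy : y ∈ L <;> simp [hy]
    _ = ∫⁻ w, ∫⁻ x in K, L.indicator 1 (x - w) * f w ∂μ ∂μ := by
        refine lintegral_lintegral_swap (Measurable.aemeasurable ?_)
        exact ((measurable_one.indicator hL).comp hsub).mul (hf.comp measurable_snd)
    _ = ∫⁻ w, f w * μ (K ∩ {x | x - w ∈ L}) ∂μ := by
        refine lintegral_congr fun w => ?_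
        have : (fun x => L.indicator (1 : E → ℝ≥0∞) (x - w)) = {x | x - w ∈ L}.indicator 1 := by
          ext x
          by_cases hx : x - w ∈ L <;> simp [hx]
        rw [lintegral_mul_const _ (by rw [this]; exact measurable_one.indicator (hS w)), this,
          lintegral_indicator_one (hS w), Measure.restrict_apply (hS w), Set.inter_comm, mul_comm]

lemma abs_sub_sub_sub_le_one {a b x y : ℝ} (hx : x ∈ Set.Icc a (a + 1))
    (hy : y ∈ Set.Icc b (b + 1)) : |(x - y) - (a - b)| ≤ 1 := by
  rw [Set.mem_Icc] at hx hy
  rw [abs_le]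
  constructor <;> linarith

/-- Two unit cubes that are adjacent in the direction of the `j`-th axis: the part of the first
one that is translated into the second one by `-w` is contained in a slab of width `|w j|`. -/
lemma volume_inter_translate_le {d : ℕ} {a b : Fin d → ℝ} {j : Fin d} (hab : |a j - b j| = 1)
    (w : EuclideanSpace ℝ (Fin d)) :
    volume (euclideanBox a (fun i => a i + 1) ∩
      {x | x - w ∈ euclideanBox b (fun i => b i + 1)}) ≤ ENNReal.ofReal ‖w‖ := by
  obtain ⟨c, hc⟩ : ∃ c : ℝ, ∀ t ∈ Set.Icc (a j) (a j + 1), t - w j ∈ Set.Icc (b j) (b j + 1) →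
      t ∈ Set.Icc c (c + |w j|) := by
    rcases abs_eq zero_le_one |>.1 hab with h | h
    · refine ⟨a j, fun t ht ht' => ⟨ht.1, ?_⟩⟩
      linarith [ht'.2, le_abs_self (w j)]
    · refine ⟨a j + 1 - |w j|, fun t ht ht' => ⟨?_, ?_⟩⟩
      · linarith [ht'.1, neg_abs_le (w j)]
      · linarith [ht.2]
  have hsub : euclideanBox a (fun i => a i + 1) ∩
      {x | x - w ∈ euclideanBox b (fun i => b i + 1)} ⊆
      euclideanBox (Function.update a j c)
        (Function.update (fun i => a i + 1) j (c + |w j|)) := by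
    rintro x ⟨hx, hx'⟩ i
    rcases eq_or_ne i j with rfl | hi
    · simpa using hc (x i) (hx i) (hx' i)
    · simpa [hi] using hx i
  refine (measure_mono hsub).trans ?_
  rw [volume_euclideanBox, Finset.prod_eq_single j]
  · simpa using ENNReal.ofReal_le_ofReal (PiLp.norm_apply_le w j)
  · intro i _ hi
    simp [hi]
  · simp

lemma lintegral_adjacent_cubes_le {d : ℕ} {β : ℝ} {a b : Fin d → ℝ} {j : Fin d}
    (hj : |a j - b j| = 1) (hab : ∀ i, |a i - b i| ≤ 1) :
    ∫⁻ x in euclideanBox a (fun i => a i + 1), ∫⁻ y in euclideanBox b (fun i => b i + 1),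
        ENNReal.ofReal (‖x - y‖ ^ β) ≤
      ∫⁻ w in Metric.ball (0 : EuclideanSpace ℝ (Fin d)) (d * 2 + 1),
        ENNReal.ofReal (‖w‖ ^ (β + 1)) := by
  rw [setLIntegral_setLIntegral_sub (f := fun w => ENNReal.ofReal (‖w‖ ^ β))
    (measurableSet_euclideanBox _ _) (by fun_prop),
    ← lintegral_indicator Metric.isOpen_ball.measurableSet]
  refine lintegral_mono fun w => ?_
  by_cases hw : w ∈ Metric.ball 0 (d * 2 + 1 : ℝ)
  · rw [Set.indicator_of_mem hw]
    refine (mul_le_mul_right (volume_inter_translate_le hj w) _).trans ?_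
    rcases eq_or_ne w 0 with rfl | h0
    · simp
    · rw [Real.rpow_add_one (norm_ne_zero_iff.2 h0), ENNReal.ofReal_mul (by positivity)]
  · rw [Set.indicator_of_notMem hw]
    suffices h : euclideanBox a (fun i => a i + 1) ∩
        {x | x - w ∈ euclideanBox b (fun i => b i + 1)} = ∅ by simp [h]
    refine Set.eq_empty_of_forall_notMem fun x ⟨hx, hx'⟩ => hw ?_
    have : ‖w‖ ≤ d * 2 := by
      refine EuclideanSpace.norm_le_mul_of_abs_apply_le fun i => ?_
      have h := abs_sub_sub_sub_le_one (hx i) (hx' i)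
      rw [PiLp.sub_apply, sub_sub_cancel] at h
      linarith [abs_sub_abs_le_abs_sub (w i) (a i - b i), hab i]
    rw [mem_ball_zero_iff]
    linarith

lemma rpow_le_rpow_add_rpow_of_mem_Icc {s t u : ℝ} (hs : 0 < s) (hst : s ≤ t) (htu : t ≤ u)
    (β : ℝ) : t ^ β ≤ s ^ β + u ^ β := by
  have ht := hs.trans_le hst
  rcases le_total 0 β with h | h
  · linarith [Real.rpow_le_rpow ht.le htu h, Real.rpow_nonneg hs.le β]
  · linarith [Real.rpow_le_rpow_of_nonpos hs hst h, Real.rpow_nonneg (ht.le.trans htu) β]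

lemma lintegral_separated_cubes_le {d : ℕ} {β m : ℝ} {a b : Fin d → ℝ} {j : Fin d} (hm : 2 ≤ m)
    (hj : |a j - b j| = m) (hab : ∀ i, |a i - b i| ≤ m) :
    ∫⁻ x in euclideanBox a (fun i => a i + 1), ∫⁻ y in euclideanBox b (fun i => b i + 1),
        ENNReal.ofReal (‖x - y‖ ^ β) ≤
      ENNReal.ofReal (((1 / 2) ^ β + (d * 2) ^ β) * m ^ β) := by
  calc ∫⁻ x in euclideanBox a (fun i => a i + 1), ∫⁻ y in euclideanBox b (fun i => b i + 1),
        ENNReal.ofReal (‖x - y‖ ^ β)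
      ≤ ∫⁻ _ in euclideanBox a (fun i => a i + 1), ∫⁻ _ in euclideanBox b (fun i => b i + 1),
        ENNReal.ofReal (((1 / 2) ^ β + (d * 2) ^ β) * m ^ β) := by
        refine setLIntegral_mono' (measurableSet_euclideanBox _ _) fun x hx =>
          setLIntegral_mono' (measurableSet_euclideanBox _ _) fun y hy =>
          ENNReal.ofReal_le_ofReal ?_
        rw [add_mul, ← Real.mul_rpow (by norm_num) (by linarith),
          ← Real.mul_rpow (by positivity) (by linarith)]
        refine rpow_le_rpow_add_rpow_of_mem_Icc (by linarith) ?_ ?_ β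
        · have h := abs_sub_sub_sub_le_one (hx j) (hy j)
          rw [abs_sub_comm] at h
          have h' := PiLp.norm_apply_le (x - y) j
          rw [PiLp.sub_apply, Real.norm_eq_abs] at h'
          linarith [abs_sub_abs_le_abs_sub (a j - b j) (x j - y j)]
        · rw [mul_assoc]
          refine EuclideanSpace.norm_le_mul_of_abs_apply_le fun i => ?_
          have h := abs_sub_sub_sub_le_one (hx i) (hy i)
          rw [PiLp.sub_apply]
          linarith [abs_sub_abs_le_abs_sub (x i - y i) (a i - b i), hab i]
    _ = ENNReal.ofReal (((1 / 2) ^ β + (d * 2) ^ β) * m ^ β) := by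
        simp [volume_euclideanBox_add_one]

/-- For `β > −d−1` there is a constant `C > 0` such that for all distinct
lattice points `k, l ∈ ℤ^d`,
`∫_{k+[0,1]^d} ∫_{l+[0,1]^d} ‖x−y‖^β dx dy ≤ C (max_j |k_j − l_j|)^β`. -/
theorem integral_cubes_dist_rpow_le
    (d : ℕ) (hd : 1 ≤ d) (β : ℝ) (hβ : -(d : ℝ) - 1 < β) :
    ∃ C : ℝ, 0 < C ∧
      ∀ k l : Fin d → ℤ, k ≠ l →
        (∫⁻ x : EuclideanSpace ℝ (Fin d) in
            {x : EuclideanSpace ℝ (Fin d) | ∀ j, x j ∈ Set.Icc (k j : ℝ) ((k j : ℝ) + 1)},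
          ∫⁻ y : EuclideanSpace ℝ (Fin d) in
            {y : EuclideanSpace ℝ (Fin d) | ∀ j, y j ∈ Set.Icc (l j : ℝ) ((l j : ℝ) + 1)},
            ENNReal.ofReal (‖x - y‖ ^ β)) ≤
        ENNReal.ofReal
          (C * (((Finset.univ.sup fun j => (k j - l j).natAbs) : ℕ) : ℝ) ^ β) := by
  set I := ∫⁻ w in Metric.ball (0 : EuclideanSpace ℝ (Fin d)) (d * 2 + 1),
    ENNReal.ofReal (‖w‖ ^ (β + 1)) with hI_def
  have hI : I < ∞ := lintegral_ball_norm_rpow_lt_top hd (by linarith) _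
  have hA : (0 : ℝ) < (1 / 2) ^ β + (d * 2) ^ β := by positivity
  refine ⟨(1 / 2) ^ β + (d * 2) ^ β + I.toReal, by positivity, fun k l hkl => ?_⟩
  set m := Finset.univ.sup fun j => (k j - l j).natAbs with hm_def
  have hcast (i : Fin d) : |(k i : ℝ) - l i| = ((k i - l i).natAbs : ℝ) := by
    rw [Nat.cast_natAbs]
    push_cast
    rfl
  have hle (i : Fin d) : |(k i : ℝ) - l i| ≤ m := by
    rw [hcast]
    exact_mod_cast Finset.le_sup (f := fun j => (k j - l j).natAbs) (Finset.mem_univ i)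
  obtain ⟨j, hj⟩ : ∃ j, |(k j : ℝ) - l j| = m := by
    obtain ⟨j, -, h⟩ := Finset.exists_mem_eq_sup Finset.univ ⟨⟨0, hd⟩, Finset.mem_univ _⟩
      fun j => (k j - l j).natAbs
    exact ⟨j, by rw [hcast, hm_def, h]⟩
  have hm : m ≠ 0 := by
    intro h0
    refine hkl (funext fun i => ?_)
    have h := hle i
    rw [h0, Nat.cast_zero, abs_nonpos_iff, sub_eq_zero] at h
    exact_mod_cast h
  rcases eq_or_ne m 1 with h1 | h1
  · rw [h1, Nat.cast_one] at hj hle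
    refine (lintegral_adjacent_cubes_le (a := fun i => k i) (b := fun i => l i) hj hle).trans ?_
    rw [h1, Nat.cast_one, Real.one_rpow, mul_one, ← hI_def, ← ENNReal.ofReal_toReal hI.ne]
    exact ENNReal.ofReal_le_ofReal (by simpa using hA.le)
  · have h2 : (2 : ℝ) ≤ m := by
      exact_mod_cast show 2 ≤ m by omega
    refine (lintegral_separated_cubes_le (a := fun i => k i) (b := fun i => l i) h2 hj hle).trans ?_
    refine ENNReal.ofReal_le_ofReal ?_
    exact mul_le_mul_of_nonneg_right (le_add_of_nonneg_right ENNReal.toReal_nonneg) (by positivity)
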